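/- arXiv:1502.03332 — 3 statements merged into one kernel-verified Lean document; each statement's English description precedes it below -/
import Mathlib

section
/- Let T be a k×k real matrix with nonnegative entries whose row sums are all at most 1. Suppose that for every index i there is a path in the directed graph on {1,…,k} with an edge from a to b whenever T_{ab} > 0, leading from i to some index j whose row sum Σ_b T_{jb} is strictly less than 1. Then T^m → 0 as m → ∞, and the matrix I − T is invertible. -/
open scoped Classical BigOperators

/-- If `T` is a nonnegative matrix with row sums at most 1 such that from
every index there is a path (in the digraph with an edge `(a,b)` whenever `T a b > 0`)
to an index whose row sum is strictly less than 1, then `T^m → 0` and `I - T` is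
invertible. -/
theorem substochastic_transient_pow_tendsto_zero
    (k : ℕ)
    (T : Matrix (Fin k) (Fin k) ℝ)
    (hnn : ∀ i j, 0 ≤ T i j)
    (hrow : ∀ i, ∑ j, T i j ≤ 1)
    (hpath : ∀ i : Fin k, ∃ j : Fin k,
      Relation.ReflTransGen (fun a b => 0 < T a b) i j ∧ ∑ b, T j b < 1) :
    Filter.Tendsto (fun m => T ^ m) Filter.atTop (nhds 0) ∧ IsUnit (1 - T) := by
  have hmv : ∀ (A : Matrix (Fin k) (Fin k) ℝ) (v : Fin k → ℝ) (i : Fin k),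
      A.mulVec v i = ∑ j, A i j * v j := fun _ _ _ => rfl
  have hr0 : ∀ m i, 0 ≤ ((T ^ m).mulVec 1) i := by
    intro m
    induction m with
    | zero => intro i; simp
    | succ m ih =>
      intro i
      rw [pow_succ', ← Matrix.mulVec_mulVec, hmv]
      exact Finset.sum_nonneg fun j _ => mul_nonneg (hnn i j) (ih j)
  have hpn : ∀ m i j, 0 ≤ (T ^ m) i j := by
    intro m
    induction m with
    | zero => intro i j; rw [pow_zero, Matrix.one_apply]; split_ifs <;> norm_num
    | succ m ih =>
      intro i j
      rw [pow_succ', Matrix.mul_apply]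
      exact Finset.sum_nonneg fun l _ => mul_nonneg (hnn i l) (ih l j)
  have hanti : ∀ i, Antitone (fun m => ((T ^ m).mulVec 1) i) := by
    intro i
    refine antitone_nat_of_succ_le fun m => ?_
    rw [pow_succ, ← Matrix.mulVec_mulVec, hmv, hmv _ 1]
    refine Finset.sum_le_sum fun j _ => mul_le_mul_of_nonneg_left ?_ (hpn m i j)
    simpa [Matrix.mulVec, dotProduct] using hrow j
  have hlim : ∀ i, ∃ r, Filter.Tendsto (fun m => ((T ^ m).mulVec 1) i) Filter.atTop (nhds r) :=
    fun i => ⟨_, tendsto_atTop_ciInf (hanti i) ⟨0, by rintro _ ⟨m, rfl⟩; exact hr0 m i⟩⟩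
  choose r hr using hlim
  have hrn : ∀ i, 0 ≤ r i := fun i => ge_of_tendsto' (hr i) fun m => hr0 m i
  have hfix : ∀ i, r i = ∑ j, T i j * r j := by
    intro i
    have h1 : Filter.Tendsto (fun m => ((T ^ (m + 1)).mulVec 1) i) Filter.atTop (nhds (r i)) :=
      (hr i).comp (Filter.tendsto_add_atTop_nat 1)
    have h2 : Filter.Tendsto (fun m => ∑ j, T i j * ((T ^ m).mulVec 1) j) Filter.atTop
        (nhds (∑ j, T i j * r j)) :=
      tendsto_finsetSum _ fun j _ => (hr j).const_mul _
    refine tendsto_nhds_unique h1 (h2.congr fun m => ?_)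
    rw [pow_succ', ← Matrix.mulVec_mulVec]
    rfl
  have hle : ∀ i, r i ≤ 0 := by
    intro i
    have : Nonempty (Fin k) := ⟨i⟩
    obtain ⟨a, ha⟩ := Finite.exists_max r
    refine (ha i).trans ?_
    by_contra! hpos
    obtain ⟨j, hj, hlt⟩ := hpath a
    have hmax : r j = r a := by
      clear hlt
      induction hj with
      | refl => rfl
      | @tail b c _ hbc ih =>
        by_contra hne
        have hc : r c < r a := lt_of_le_of_ne (ha c) hne
        have h1 : ∑ l, T b l * r l < ∑ l, T b l * r a :=
          Finset.sum_lt_sum (fun l _ => mul_le_mul_of_nonneg_left (ha l) (hnn b l))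
            ⟨c, Finset.mem_univ c, mul_lt_mul_of_pos_left hc hbc⟩
        rw [← hfix, ih, ← Finset.sum_mul] at h1
        nlinarith [hrow b]
    have h1 : ∑ l, T j l * r l ≤ ∑ l, T j l * r a :=
      Finset.sum_le_sum fun l _ => mul_le_mul_of_nonneg_left (ha l) (hnn j l)
    rw [← hfix, hmax, ← Finset.sum_mul] at h1
    nlinarith
  have hT : Filter.Tendsto (fun m => T ^ m) Filter.atTop (nhds 0) := by
    refine tendsto_pi_nhds.2 fun i => tendsto_pi_nhds.2 fun j => ?_
    have hi := hr i
    rw [le_antisymm (hle i) (hrn i)] at hi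
    refine squeeze_zero (fun m => hpn m i j) (fun m => ?_) hi
    have := Finset.single_le_sum (f := fun l => (T ^ m) i l) (fun l _ => hpn m i l)
      (Finset.mem_univ j)
    simpa [Matrix.mulVec, dotProduct] using this
  refine ⟨hT, ?_⟩
  rw [← Matrix.mulVec_injective_iff_isUnit]
  have hker : ∀ v, (1 - T).mulVec v = 0 → v = 0 := by
    intro v hv
    rw [Matrix.sub_mulVec, Matrix.one_mulVec, sub_eq_zero] at hv
    have hp : ∀ m, (T ^ m).mulVec v = v := by
      intro m
      induction m with
      | zero => simp
      | succ m ih => rw [pow_succ, ← Matrix.mulVec_mulVec, ← hv, ih]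
    have hc : Continuous fun A : Matrix (Fin k) (Fin k) ℝ => A.mulVec v :=
      continuous_id.matrix_mulVec continuous_const
    have h := (hc.tendsto 0).comp hT
    rw [Matrix.zero_mulVec] at h
    exact tendsto_nhds_unique (tendsto_const_nhds.congr fun m => (hp m).symm) h
  intro x y hxy
  have := hker (x - y) (by rw [Matrix.mulVec_sub]; exact sub_eq_zero.2 hxy)
  exact sub_eq_zero.1 this
end

section
/- For any n×n real symmetric matrix R = (r_ij) with no negative terms on the diagonal, there exist a real number r > 0 and vectors y_1,…,y_n ∈ ℝ^{n−1} such that for all i ≠ j: ‖y_i − y_j‖₂ = √( r² − r_ij² · sign(r_ij) ), where sign(x) = 1 if x ≥ 0 and sign(x) = −1 otherwise. -/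
open scoped Classical BigOperators

/-- A symmetric matrix plus a large multiple of `1 + J` is a Gram matrix. -/
lemma gram_aux (m : ℕ) (E : Matrix (Fin m) (Fin m) ℝ) (hE : ∀ i j, E i j = E j i)
    (t : ℝ) (ht : ∑ i, ∑ j, |E i j| ≤ t) :
    ∃ B : Matrix (Fin m) (Fin m) ℝ,
      ∀ i j, ∑ k, B k i * B k j = t * ((if i = j then 1 else 0) + 1) + E i j := by
  have ht0 : 0 ≤ t := le_trans (by positivity) ht
  let G : Matrix (Fin m) (Fin m) ℝ :=
    Matrix.of fun i j => t * ((if i = j then 1 else 0) + 1) + E i j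
  have hG : G.PosSemidef := by
    apply Matrix.PosSemidef.of_dotProduct_mulVec_nonneg
    · ext i j
      simp [G, hE i j, eq_comm]
    · intro x
      have h1 : star x ⬝ᵥ G.mulVec x =
          t * (∑ i, x i ^ 2) + t * (∑ i, x i) ^ 2 + ∑ i, ∑ j, E i j * (x i * x j) := by
        simp only [dotProduct, Matrix.mulVec, G, Matrix.of_apply, Pi.star_apply, star_trivial]
        rw [sq (∑ i, x i), Finset.sum_mul_sum, Finset.mul_sum, Finset.mul_sum,
          ← Finset.sum_add_distrib, ← Finset.sum_add_distrib]
        refine Finset.sum_congr rfl fun i _ => ?_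
        have : t * x i ^ 2 = ∑ j, t * (if i = j then 1 else 0) * (x i * x j) := by
          simp [sq]
        rw [this, Finset.mul_sum, Finset.mul_sum, ← Finset.sum_add_distrib,
          ← Finset.sum_add_distrib]
        refine Finset.sum_congr rfl fun j _ => ?_
        ring
      have hS : ∀ i, x i ^ 2 ≤ ∑ k, x k ^ 2 := fun i =>
        Finset.single_le_sum (f := fun k => x k ^ 2) (fun k _ => sq_nonneg _) (Finset.mem_univ i)
      have h2 : -(∑ i, ∑ j, |E i j|) * (∑ k, x k ^ 2) ≤ ∑ i, ∑ j, E i j * (x i * x j) := by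
        rw [← Finset.sum_neg_distrib, Finset.sum_mul]
        refine Finset.sum_le_sum fun i _ => ?_
        rw [← Finset.sum_neg_distrib, Finset.sum_mul]
        refine Finset.sum_le_sum fun j _ => ?_
        have h3 : |x i * x j| ≤ ∑ k, x k ^ 2 := by
          rw [abs_le]
          constructor <;> nlinarith [hS i, hS j, sq_nonneg (x i - x j), sq_nonneg (x i + x j)]
        have h4 := neg_abs_le (E i j * (x i * x j))
        rw [abs_mul] at h4
        nlinarith [mul_le_mul_of_nonneg_left h3 (abs_nonneg (E i j))]
      rw [h1]
      have h5 : 0 ≤ ∑ k, x k ^ 2 := by positivity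
      nlinarith [mul_le_mul_of_nonneg_right ht h5, mul_nonneg ht0 (sq_nonneg (∑ i, x i))]
  obtain ⟨B, hB⟩ : ∃ B : Matrix (Fin m) (Fin m) ℝ, G = B.conjTranspose * B := by
    open scoped MatrixOrder in
    exact CStarAlgebra.nonneg_iff_eq_star_mul_self.mp hG.nonneg
  refine ⟨B, fun i j => ?_⟩
  have := congrFun (congrFun hB i) j
  simpa [G, Matrix.mul_apply] using this.symm

/-- Lemma 4.1: For any symmetric real matrix `R` with nonnegative diagonal,
there exist `r > 0` and vectors `y_1, …, y_n ∈ ℝ^{n-1}` with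
`‖y_i - y_j‖ = √(r² - r_ij² · sign(r_ij))` for all `i ≠ j`, where `sign(x) = 1` if
`x ≥ 0` and `-1` otherwise. -/
theorem anchor_lemma
    (n : ℕ)
    (R : Fin n → Fin n → ℝ)
    (hsymm : ∀ i j, R i j = R j i)
    (hdiag : ∀ i, 0 ≤ R i i) :
    ∃ r > (0 : ℝ), ∃ y : Fin n → EuclideanSpace ℝ (Fin (n - 1)),
      ∀ i j : Fin n, i ≠ j →
        ‖y i - y j‖ =
          Real.sqrt (r ^ 2 - (R i j) ^ 2 * (if 0 ≤ R i j then 1 else -1)) := by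
  rcases n with _ | m
  · exact ⟨1, one_pos, fun i => i.elim0, fun i => i.elim0⟩
  obtain ⟨c, hc⟩ : ∃ c : Fin (m+1) → Fin (m+1) → ℝ,
      ∀ i j, c i j = (R i j) ^ 2 * (if 0 ≤ R i j then 1 else -1) := ⟨_, fun _ _ => rfl⟩
  have hcs : ∀ i j, c i j = c j i := fun i j => by rw [hc, hc, hsymm]
  simp only [← hc]
  let E : Matrix (Fin m) (Fin m) ℝ := Matrix.of fun i j =>
    (-c 0 i.succ - c 0 j.succ + (if i = j then 0 else c i.succ j.succ)) / 2
  have hE : ∀ i j, E i j = E j i := fun i j => by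
    simp only [E, Matrix.of_apply, hcs i.succ j.succ, eq_comm (a := i)]
    ring
  set M := ∑ i, ∑ j, |E i j| with hM
  have hM0 : 0 ≤ M := by positivity
  obtain ⟨B, hB⟩ := gram_aux m E hE ((2 * M + 1) ^ 2 / 2) (by rw [← hM]; nlinarith)
  refine ⟨2 * M + 1, by positivity,
    fun i => WithLp.toLp 2 (fun k : Fin m => (Fin.cons 0 (fun a => B k a) : Fin (m+1) → ℝ) i), ?_⟩
  intro i j hij
  rw [EuclideanSpace.norm_eq]
  congr 1
  simp only [PiLp.sub_apply, Real.norm_eq_abs, sq_abs]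
  generalize 2 * M + 1 = r at *
  have hd : ∀ a, ∑ k, B k a ^ 2 = r ^ 2 - c 0 a.succ := fun a => by
    have := hB a a
    simp only [← sq] at this
    rw [this]; simp [E]; ring
  rcases Fin.eq_zero_or_eq_succ i with rfl | ⟨a, rfl⟩
  · rcases Fin.eq_zero_or_eq_succ j with rfl | ⟨b, rfl⟩
    · exact absurd rfl hij
    · simpa using hd b
  · rcases Fin.eq_zero_or_eq_succ j with rfl | ⟨b, rfl⟩
    · simpa [hcs a.succ 0] using hd a
    · have hab : a ≠ b := fun h => hij (by rw [h])
      have h1 := hB a b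
      simp only [E, Matrix.of_apply, if_neg hab] at h1
      have h2 : ∑ k, (B k a - B k b) ^ 2 =
          ∑ k, B k a ^ 2 + ∑ k, B k b ^ 2 - 2 * ∑ k, B k a * B k b := by
        rw [Finset.mul_sum, ← Finset.sum_add_distrib, ← Finset.sum_sub_distrib]
        exact Finset.sum_congr rfl fun k _ => by ring
      simp only [Fin.cons_succ]
      refine h2.trans ?_
      rw [hd, hd, h1]
      ring
end

section
/- For every integer n > 0 there exists γ > 0, depending only on n, with the following property: for any real numbers t_ij (0 ≤ i < j ≤ n) satisfying |1 − t_ij| ≤ γ, there exist vectors y^(0), y^(1), …, y^(n) ∈ ℝ^n such that ‖y^(i) − y^(j)‖₂ = t_ij for all 0 ≤ i < j ≤ n. -/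
open scoped Classical BigOperators

lemma nud_quad {n : ℕ} (hn : 0 < n) (G : Matrix (Fin n) (Fin n) ℝ)
    (hG : ∀ i j, |G i j - (1 / 2 + if i = j then 1 / 2 else 0)| ≤ 1 / (2 * n)) (x : Fin n → ℝ) :
    0 ≤ ∑ i, ∑ j, x i * (G i j * x j) := by
  have hn' : (0 : ℝ) < n := by exact_mod_cast hn
  have h1 : ∀ i j, x i * x j / 2 + (if i = j then x i * x j / 2 else 0)
      - 1 / (2 * n) * (|x i| * |x j|) ≤ x i * (G i j * x j) := by
    intro i j
    have h := hG i j
    have h2 : |(G i j - (1 / 2 + if i = j then 1 / 2 else 0)) * (x i * x j)|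
        ≤ 1 / (2 * n) * (|x i| * |x j|) := by
      rw [abs_mul, abs_mul]
      gcongr
    have h3 := (abs_le.mp h2).1
    split_ifs at h3 ⊢ <;> nlinarith
  have h2 : ∑ i, ∑ j, (x i * x j / 2 + (if i = j then x i * x j / 2 else 0)
      - 1 / (2 * n) * (|x i| * |x j|)) ≤ ∑ i, ∑ j, x i * (G i j * x j) :=
    Finset.sum_le_sum fun i _ => Finset.sum_le_sum fun j _ => h1 i j
  refine le_trans ?_ h2
  have h3 : ∑ i, ∑ j, (x i * x j / 2 + (if i = j then x i * x j / 2 else 0)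
      - 1 / (2 * n) * (|x i| * |x j|))
      = (∑ i, x i) ^ 2 / 2 + (∑ i, |x i| ^ 2) / 2 - 1 / (2 * n) * (∑ i, |x i|) ^ 2 := by
    simp only [Finset.sum_sub_distrib, Finset.sum_add_distrib, ← Finset.mul_sum, ← Finset.sum_div,
      Finset.sum_ite_eq, Finset.mem_univ, if_true, ← Finset.sum_mul, sq_abs]
    simp only [sq]
  rw [h3]
  have h4 : (∑ i, |x i|) ^ 2 ≤ n * ∑ i, |x i| ^ 2 := by
    simpa using sq_sum_le_card_mul_sum_sq (s := Finset.univ) (f := fun i => |x i|)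
  have h5 : 1 / (2 * n) * (∑ i, |x i|) ^ 2 ≤ 1 / (2 * n) * (n * ∑ i, |x i| ^ 2) := by gcongr
  have h6 : 1 / (2 * n) * (n * ∑ i, |x i| ^ 2) = (∑ i, |x i| ^ 2) / 2 := by field_simp
  nlinarith [sq_nonneg (∑ i, x i)]

lemma nud_gram {n : ℕ} (G : Matrix (Fin n) (Fin n) ℝ) (hG : G.PosSemidef) :
    ∃ v : Fin n → EuclideanSpace ℝ (Fin n), ∀ i j, inner ℝ (v i) (v j) = G i j := by
  open scoped MatrixOrder in
  obtain ⟨B, hB⟩ := CStarAlgebra.nonneg_iff_eq_star_mul_self.mp hG.nonneg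
  refine ⟨fun i => WithLp.toLp 2 (fun k => B k i), fun i j => ?_⟩
  rw [hB]
  simp [PiLp.inner_apply, Matrix.mul_apply, Matrix.star_apply, mul_comm]

/-- Fact B: For every `n > 0` there exists `γ > 0` depending only on `n`
such that any prescribed pairwise distances `t i j` (`0 ≤ i < j ≤ n`) with
`|1 - t i j| ≤ γ` are realized by `n + 1` points `y⁽⁰⁾, …, y⁽ⁿ⁾ ∈ ℝⁿ`. -/
theorem near_unit_distances_realizable
    (n : ℕ) (hn : 0 < n) :
    ∃ γ > (0 : ℝ), ∀ t : Fin (n + 1) → Fin (n + 1) → ℝ,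
      (∀ i j : Fin (n + 1), i < j → |1 - t i j| ≤ γ) →
      ∃ y : Fin (n + 1) → EuclideanSpace ℝ (Fin n),
        ∀ i j : Fin (n + 1), i < j → ‖y i - y j‖ = t i j := by
  have hn' : (1 : ℝ) ≤ n := by exact_mod_cast hn
  refine ⟨1 / (9 * n), by positivity, fun t ht => ?_⟩
  have hγ : 1 / (9 * (n : ℝ)) ≤ 1 / 9 := by
    apply one_div_le_one_div_of_le <;> linarith
  have hγ2 : 1 / (2 * (n : ℝ)) = 9 / 2 * (1 / (9 * (n : ℝ))) := by field_simp
  have hγ0 : 0 < 1 / (9 * (n : ℝ)) := by positivity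
  set γ := 1 / (9 * (n : ℝ)) with hγdef
  let s : Fin (n + 1) → Fin (n + 1) → ℝ := fun i j =>
    if i = j then 0 else t (min i j) (max i j) ^ 2
  have hs_self : ∀ i, s i i = 0 := fun i => by simp [s]
  have hs_symm : ∀ i j, s i j = s j i := fun i j => by
    simp only [s, min_comm i j, max_comm i j, eq_comm (a := i)]
  have hs_lt : ∀ i j, i < j → s i j = t i j ^ 2 := fun i j h => by
    simp [s, h.ne, min_eq_left h.le, max_eq_right h.le]
  have hs_b' : ∀ i j, i < j → |s i j - 1| ≤ 3 * γ := fun i j h => by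
    rw [hs_lt i j h]
    have := abs_le.mp (ht i j h)
    rw [abs_le]
    constructor <;> nlinarith [sq_nonneg (1 - t i j)]
  have hs_b : ∀ i j, i ≠ j → |s i j - 1| ≤ 3 * γ := fun i j h => by
    rcases lt_or_gt_of_ne h with h | h
    · exact hs_b' i j h
    · rw [hs_symm]; exact hs_b' j i h
  let G : Matrix (Fin n) (Fin n) ℝ := Matrix.of fun i j =>
    (s 0 i.succ + s 0 j.succ - s i.succ j.succ) / 2
  have hGd : ∀ i j, G i j = (s 0 i.succ + s 0 j.succ - s i.succ j.succ) / 2 := fun i j => rfl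
  have hGb : ∀ i j, |G i j - (1 / 2 + if i = j then 1 / 2 else 0)| ≤ 1 / (2 * n) := by
    intro i j
    rw [hγ2, hGd]
    have a := abs_le.mp (hs_b 0 i.succ (Fin.succ_ne_zero i).symm)
    have b := abs_le.mp (hs_b 0 j.succ (Fin.succ_ne_zero j).symm)
    rw [abs_le]
    split_ifs with h
    · subst h
      rw [hs_self]
      constructor <;> linarith
    · have c := abs_le.mp (hs_b i.succ j.succ (fun e => h (Fin.succ_injective _ e)))
      constructor <;> linarith
  have hGp : G.PosSemidef := by
    refine Matrix.PosSemidef.of_dotProduct_mulVec_nonneg ?_ fun x => ?_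
    · ext i j
      simp only [Matrix.conjTranspose_apply, star_trivial, hGd, hs_symm j.succ i.succ]
      ring
    · have := nud_quad hn G hGb x
      simpa [dotProduct, Matrix.mulVec, Finset.mul_sum] using this
  obtain ⟨v, hv⟩ := nud_gram G hGp
  have hvn : ∀ i, ‖v i‖ ^ 2 = s 0 i.succ := fun i => by
    rw [← real_inner_self_eq_norm_sq, hv, hGd, hs_self]; ring
  refine ⟨Fin.cons 0 v, fun i j hij => ?_⟩
  have htn : 0 ≤ t i j := by have := abs_le.mp (ht i j hij); linarith
  rw [← sq_eq_sq₀ (norm_nonneg _) htn, ← hs_lt i j hij]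
  induction j using Fin.cases with
  | zero => exact absurd hij (Fin.not_lt_zero i)
  | succ j =>
    induction i using Fin.cases with
    | zero => simp [hvn]
    | succ i =>
      simp only [Fin.cons_succ]
      rw [norm_sub_sq_real, hvn, hvn, hv, hGd]
      ring
end
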